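/- Let S₁,…,S_m be n-dimensional simplices in ℝⁿ, each with vertices x_{i1},…,x_{i,n+1} on the unit sphere and circumcenter at the origin, with barycentric coordinates α_{ij} of the circumcenter, and associated symmetric maps Q_{S₁},…,Q_{S_m}. Suppose Q_{S₁},…,Q_{S_m} are linearly independent and there exist nonnegative reals υ₁,…,υ_m with Σᵢ υᵢ Q_{Sᵢ} = Id. Then for every family of reals (ρ_{ij})_{i=1..m, j=1..n+1} there exist a symmetric linear map M on ℝⁿ and vectors t₁,…,t_m ∈ ℝⁿ such that ⟨x_{ij}, M x_{ij}⟩ + ⟨x_{ij}, tᵢ⟩ = ρ_{ij} for all i, j, and trace M = Σ_{i,j} υᵢ α_{ij} ρ_{ij}; moreover M and t₁,…,t_m can be chosen to depend linearly on the data (ρ_{ij}). -/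

import Mathlib

open Set Pointwise MeasureTheory
open scoped RealInnerProductSpace

noncomputable section

abbrev Euc (n : ℕ) := EuclideanSpace ℝ (Fin n)

/-- The symmetric map `Q_S` associated to a simplex `S` with vertices `x j` on the unit
sphere and barycentric coordinates `α j` of the circumcenter:
`Q_S(v) = Σⱼ αⱼ ⟨xⱼ, v⟩ xⱼ`. -/
def QS {n : ℕ} (x : Fin (n + 1) → Euc n) (α : Fin (n + 1) → ℝ) : Euc n →ₗ[ℝ] Euc n :=
  ∑ j, α j • ((innerSL ℝ (x j)).toLinearMap.smulRight (x j))

lemma QS_apply {n : ℕ} (x : Fin (n + 1) → Euc n) (α : Fin (n + 1) → ℝ) (v : Euc n) :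
    QS x α v = ∑ j, α j • ⟪x j, v⟫ • x j := by
  simp [QS, LinearMap.sum_apply]

lemma QS_isSymmetric {n : ℕ} (x : Fin (n + 1) → Euc n) (α : Fin (n + 1) → ℝ) :
    (QS x α).IsSymmetric := by
  intro v w
  simp only [QS_apply, sum_inner, inner_sum, real_inner_smul_left, real_inner_smul_right]
  refine Finset.sum_congr rfl fun j _ => ?_
  rw [real_inner_comm v (x j)]
  ring

lemma inner_QS_self {n : ℕ} (x : Fin (n + 1) → Euc n) (α : Fin (n + 1) → ℝ) (v : Euc n) :
    ⟪QS x α v, v⟫ = ∑ j, α j * (⟪x j, v⟫ * ⟪x j, v⟫) := by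
  simp only [QS_apply, sum_inner, real_inner_smul_left]

lemma trace_comp_QS {n : ℕ} (x : Fin (n + 1) → Euc n) (α : Fin (n + 1) → ℝ)
    (M : Euc n →ₗ[ℝ] Euc n) :
    LinearMap.trace ℝ (Euc n) (M ∘ₗ QS x α) = ∑ j, α j * ⟪x j, M (x j)⟫ := by
  have h : M ∘ₗ QS x α = ∑ j, α j • (innerSL ℝ (x j)).toLinearMap.smulRight (M (x j)) := by
    ext1 v
    simp [QS_apply, LinearMap.sum_apply]
  rw [h]
  simp [LinearMap.trace_smulRight]

/-- The linear relations among affinely independent vectors are the multiples of the barycentric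
coordinates of the origin. -/
lemma AffineIndependent.eq_sum_smul_of_sum_smul_eq_zero {ι V : Type*} [Fintype ι]
    [AddCommGroup V] [Module ℝ V] {p : ι → V} (hp : AffineIndependent ℝ p) {α c : ι → ℝ}
    (hα1 : ∑ j, α j = 1) (hα0 : ∑ j, α j • p j = 0) (hc : ∑ j, c j • p j = 0) (j : ι) :
    c j = (∑ k, c k) * α j := by
  have h := affineIndependent_iff.1 hp Finset.univ (fun j => c j - (∑ k, c k) * α j)
    (by rw [Finset.sum_sub_distrib, ← Finset.mul_sum, hα1, mul_one, sub_self])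
    (by simp only [sub_smul, mul_smul, Finset.sum_sub_distrib, ← Finset.smul_sum, hα0, hc,
          smul_zero, sub_zero])
    j (Finset.mem_univ j)
  exact sub_eq_zero.1 h

/-- The subspace of symmetric linear maps. -/
def symmetricMaps (n : ℕ) : Submodule ℝ (Euc n →ₗ[ℝ] Euc n) where
  carrier := {M | M.IsSymmetric}
  add_mem' := fun hM hN => hM.add hN
  zero_mem' := LinearMap.IsSymmetric.zero
  smul_mem' := fun c _ hM => hM.smul (by simp)

/-- The linear map sending `(M, t)` to the family `⟨x_{ij}, M x_{ij}⟩ + ⟨x_{ij}, tᵢ⟩`. -/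
def evalMap {n m : ℕ} (x : Fin m → Fin (n + 1) → Euc n) :
    symmetricMaps n × (Fin m → Euc n) →ₗ[ℝ] (Fin m → Fin (n + 1) → ℝ) where
  toFun p := fun i j => ⟪x i j, p.1.1 (x i j)⟫ + ⟪x i j, p.2 i⟫
  map_add' p q := by
    ext i j
    simp [inner_add_right]
    ring
  map_smul' c p := by
    ext i j
    simp [real_inner_smul_right]
    ring

lemma evalMap_surjective {n m : ℕ} {x : Fin m → Fin (n + 1) → Euc n}
    (haff : ∀ i, AffineIndependent ℝ (x i)) {α : Fin m → Fin (n + 1) → ℝ}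
    (hα1 : ∀ i, ∑ j, α i j = 1) (hα0 : ∀ i, ∑ j, α i j • x i j = 0)
    (hQind : LinearIndependent ℝ fun i => QS (x i) (α i)) :
    Function.Surjective (evalMap x) := by
  rw [← LinearMap.dualMap_injective_iff, injective_iff_map_eq_zero]
  intro φ hφ
  let c : Fin m → Fin (n + 1) → ℝ := fun i j => φ (Pi.single i (Pi.single j 1))
  have hφc : ∀ r, φ r = ∑ i, ∑ j, c i j * r i j := by
    intro r
    have hr : r = ∑ i, ∑ j, r i j • Pi.single i (Pi.single j (1 : ℝ)) := by
      ext i j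
      simp [Finset.sum_apply, Pi.single_apply, apply_ite, ite_apply]
    conv_lhs => rw [hr]
    simp only [map_sum, map_smul, smul_eq_mul, c, mul_comm]
  have hzero : ∀ p, ∑ i, ∑ j, c i j * evalMap x p i j = 0 := fun p => by
    rw [← hφc]
    exact LinearMap.congr_fun hφ p
  have hc : ∀ i, ∑ j, c i j • x i j = 0 := by
    intro i
    refine ext_inner_right ℝ fun v => ?_
    have h := hzero (0, Pi.single i v)
    rw [Finset.sum_eq_single i (fun k _ hk => by simp [evalMap, Pi.single_eq_of_ne hk])
      (by simp)] at h
    simpa [evalMap, sum_inner, real_inner_smul_left] using h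
  have hcα : ∀ i j, c i j = (∑ k, c i k) * α i j := fun i =>
    (haff i).eq_sum_smul_of_sum_smul_eq_zero (hα1 i) (hα0 i) (hc i)
  have hsym : (∑ i, (∑ k, c i k) • QS (x i) (α i)).IsSymmetric :=
    (symmetricMaps n).sum_mem fun i _ => (symmetricMaps n).smul_mem _ (QS_isSymmetric _ _)
  have hQ : ∑ i, (∑ k, c i k) • QS (x i) (α i) = 0 := by
    refine hsym.inner_map_self_eq_zero.1 fun v => ?_
    have hv : (innerSL ℝ v).toLinearMap.smulRight v ∈ symmetricMaps n := fun a b => by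
      simp [real_inner_smul_right, real_inner_comm, mul_comm]
    have h := hzero (⟨_, hv⟩, 0)
    simp only [LinearMap.sum_apply, LinearMap.smul_apply, sum_inner, real_inner_smul_left,
      inner_QS_self, Finset.mul_sum]
    rw [← h]
    refine Finset.sum_congr rfl fun i _ => Finset.sum_congr rfl fun j _ => ?_
    rw [hcα i j]
    simp [evalMap, real_inner_smul_right, real_inner_comm v (x i j), mul_assoc]
  have hs : ∀ i, ∑ k, c i k = 0 := Fintype.linearIndependent_iff.1 hQind _ hQ
  have hc0 : ∀ i j, c i j = 0 := fun i j => by rw [hcα, hs, zero_mul]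
  refine LinearMap.ext fun r => ?_
  simp [hφc, hc0]

/-- Given simplices inscribed in the unit sphere with circumcenters at the origin whose
associated maps `Q_{Sᵢ}` are linearly independent and semi-eutactic
(`Σᵢ υᵢ Q_{Sᵢ} = Id`, `υᵢ ≥ 0`), for every data `ρ_{ij}` there are a symmetric map `M` and
vectors `tᵢ`, depending linearly on `ρ`, with `⟨x_{ij}, M x_{ij}⟩ + ⟨x_{ij}, tᵢ⟩ = ρ_{ij}`
and `trace M = Σ_{ij} υᵢ α_{ij} ρ_{ij}`. -/
theorem exists_linear_correction {n m : ℕ} (x : Fin m → Fin (n + 1) → Euc n)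
    (hx : ∀ i j, ‖x i j‖ = 1) (haff : ∀ i, AffineIndependent ℝ (x i))
    (α : Fin m → Fin (n + 1) → ℝ)
    (hα1 : ∀ i, ∑ j, α i j = 1) (hα0 : ∀ i, ∑ j, α i j • x i j = 0)
    (hQind : LinearIndependent ℝ fun i => QS (x i) (α i))
    (υ : Fin m → ℝ) (hυ : ∀ i, 0 ≤ υ i)
    (heut : ∑ i, υ i • QS (x i) (α i) = LinearMap.id) :
    ∃ (Mmap : (Fin m → Fin (n + 1) → ℝ) →ₗ[ℝ] (Euc n →ₗ[ℝ] Euc n))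
      (tmap : (Fin m → Fin (n + 1) → ℝ) →ₗ[ℝ] (Fin m → Euc n)),
      ∀ ρ : Fin m → Fin (n + 1) → ℝ,
        (Mmap ρ).IsSymmetric ∧
        (∀ i j, ⟪x i j, (Mmap ρ) (x i j)⟫ + ⟪x i j, tmap ρ i⟫ = ρ i j) ∧
        LinearMap.trace ℝ (Euc n) (Mmap ρ) = ∑ i, ∑ j, υ i * α i j * ρ i j := by
  obtain ⟨R, hR⟩ := (evalMap x).exists_rightInverse_of_surjective
    (LinearMap.range_eq_top.2 (evalMap_surjective haff hα1 hα0 hQind))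
  refine ⟨(symmetricMaps n).subtype ∘ₗ LinearMap.fst ℝ _ _ ∘ₗ R, LinearMap.snd ℝ _ _ ∘ₗ R,
    fun ρ => ?_⟩
  have hρ : ∀ i j, ⟪x i j, (R ρ).1.1 (x i j)⟫ + ⟪x i j, (R ρ).2 i⟫ = ρ i j := fun i j =>
    congrFun (congrFun (LinearMap.congr_fun hR ρ) i) j
  refine ⟨(R ρ).1.2, hρ, ?_⟩
  change LinearMap.trace ℝ (Euc n) (R ρ).1.1 = _
  have ht : ∀ i, ∑ j, α i j * ⟪x i j, (R ρ).2 i⟫ = 0 := fun i => by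
    simp only [← real_inner_smul_left, ← sum_inner, hα0, inner_zero_left]
  have hM : (R ρ).1.1 = ∑ i, υ i • ((R ρ).1.1 ∘ₗ QS (x i) (α i)) := by
    conv_lhs => rw [← LinearMap.comp_id (R ρ).1.1, ← heut]
    ext1 v
    simp [LinearMap.sum_apply]
  rw [hM, map_sum]
  refine Finset.sum_congr rfl fun i _ => ?_
  simp only [map_smul, trace_comp_QS, smul_eq_mul, mul_assoc, ← Finset.mul_sum]
  simp only [← hρ, mul_add, Finset.sum_add_distrib, ht, add_zero]
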